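/- Let θ ∈ ℝ, σ > 0, let A ⊆ ℝ be a Lebesgue-measurable set, and let p(θ) = ν_θ(A) be the probability that a sample X ~ N(θ,σ²) lies in A. If 0 < p(θ) < 1, then p is differentiable at θ and (p'(θ))² / (p(θ)(1 − p(θ))) ≤ 2/(πσ²). In other words, the Fisher information with respect to θ of the one-bit message M = 1 if X ∈ A, M = −1 otherwise, is bounded above by 2/(πσ²). -/

import Mathlib

open Real MeasureTheory ProbabilityTheory

lemma gaussianPDFReal_zero_one (x : ℝ) :
    gaussianPDFReal 0 1 x = (√(2 * π))⁻¹ * exp (-(1 / 2) * x ^ 2) := by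
  simp only [gaussianPDFReal, sub_zero, NNReal.coe_one, mul_one]
  congr 2
  ring

lemma hasDerivAt_gaussianPDFReal_zero_one (x : ℝ) :
    HasDerivAt (gaussianPDFReal 0 1) (-(gaussianPDFReal 0 1 x * x)) x := by
  have h := (((hasDerivAt_pow 2 x).const_mul (-(1 / 2) : ℝ)).exp).const_mul (√(2 * π))⁻¹
  rw [show gaussianPDFReal 0 1 = _ from funext gaussianPDFReal_zero_one]
  convert! h using 1
  push_cast
  ring

lemma integrable_gaussianPDFReal_zero_one_mul_self :
    Integrable fun x => gaussianPDFReal 0 1 x * x := by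
  convert (integrable_mul_exp_neg_mul_sq (b := 1 / 2) (by norm_num)).const_mul
    (√(2 * π))⁻¹ using 2 with x
  rw [gaussianPDFReal_zero_one]
  ring

lemma setIntegral_gaussianReal {μ : ℝ} {v : NNReal} (hv : v ≠ 0) {s : Set ℝ}
    (hs : MeasurableSet s) (f : ℝ → ℝ) :
    ∫ x in s, f x ∂gaussianReal μ v = ∫ x in s, gaussianPDFReal μ v x * f x := by
  rw [← integral_indicator hs, integral_gaussianReal_eq_integral_smul hv,
    ← integral_indicator hs]
  congr 1 with x
  by_cases hx : x ∈ s <;> simp [hx]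

lemma setIntegral_Ioi_id_gaussianReal (t : ℝ) :
    ∫ x in Set.Ioi t, x ∂gaussianReal 0 1 = gaussianPDFReal 0 1 t := by
  rw [setIntegral_gaussianReal one_ne_zero measurableSet_Ioi]
  have hd := fun x (_ : x ∈ Set.Ici t) => hasDerivAt_gaussianPDFReal_zero_one x
  have hi := integrable_gaussianPDFReal_zero_one_mul_self
  have hlim := tendsto_zero_of_hasDerivAt_of_integrableOn_Ioi
    (fun x hx => hd x (Set.Ioi_subset_Ici_self hx)) hi.neg.integrableOn
    (integrable_gaussianPDFReal 0 1).integrableOn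
  have h := integral_Ioi_of_hasDerivAt_of_tendsto' hd hi.neg.integrableOn hlim
  rw [integral_neg] at h
  linarith

lemma integrable_id_gaussianReal (μ : ℝ) (v : NNReal) :
    Integrable (fun x => x) (gaussianReal μ v) :=
  memLp_one_iff_integrable.1 (memLp_id_gaussianReal 1)

/-- Among sets of given Gaussian measure, half-lines maximize the first moment. -/
lemma setIntegral_id_gaussianReal_le {B : Set ℝ} (hB : MeasurableSet B) {t : ℝ}
    (h : (gaussianReal 0 1).real (Set.Ioi t) = (gaussianReal 0 1).real B) :
    ∫ x in B, x ∂gaussianReal 0 1 ≤ gaussianPDFReal 0 1 t := by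
  have := nullSingletonClass_gaussianReal (μ := 0) (v := 1) one_ne_zero
  have hi := integrable_id_gaussianReal 0 1
  have key := setIntegral_le_nonneg (f := fun x => x - t) hB
    (by fun_prop) (hi.sub (integrable_const t))
  simp only [sub_nonneg] at key
  change _ ≤ ∫ x in Set.Ici t, x - t ∂_ at key
  rw [integral_Ici_eq_integral_Ioi,
    integral_sub hi.integrableOn (integrable_const t).integrableOn,
    integral_sub hi.integrableOn (integrable_const t).integrableOn,
    setIntegral_const, setIntegral_const, h, setIntegral_Ioi_id_gaussianReal] at key
  linarith

lemma exists_gaussianReal_Ioi_eq {p : ℝ} (h0 : 0 < p) (h1 : p < 1) :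
    ∃ t, (gaussianReal 0 1).real (Set.Ioi t) = p := by
  have := nullSingletonClass_gaussianReal (μ := 0) (v := 1) one_ne_zero
  set γ := gaussianReal 0 1
  have hc : Continuous (cdf γ) := by
    have h1 := integrable_const (μ := γ) (1 : ℝ)
    convert! (h1.continuous_primitive 0).add_const (cdf γ 0) using 2 with x
    rw [← intervalIntegral.integral_Iic_sub_Iic h1.integrableOn h1.integrableOn]
    simp [cdf_eq_real]
  obtain ⟨t, ht⟩ := mem_range_of_exists_le_of_exists_ge hc (c := 1 - p)
    (((tendsto_cdf_atBot γ).eventually (ge_mem_nhds (by linarith))).exists)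
    (((tendsto_cdf_atTop γ).eventually (le_mem_nhds (by linarith))).exists)
  refine ⟨t, ?_⟩
  rw [← Set.compl_Iic, probReal_compl_eq_one_sub measurableSet_Iic, ← cdf_eq_real, ht]
  ring

lemma setIntegral_disc_gaussianPDFReal {R : ℝ} (hR : 0 ≤ R) :
    ∫ z in {z : ℝ × ℝ | z.1 ^ 2 + z.2 ^ 2 ≤ R ^ 2},
        gaussianPDFReal 0 1 z.1 * gaussianPDFReal 0 1 z.2 = 1 - exp (-R ^ 2 / 2) := by
  have hpi : (√(2 * π))⁻¹ * (√(2 * π))⁻¹ = (2 * π)⁻¹ := by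
    rw [← mul_inv, mul_self_sqrt (by positivity)]
  have hradial : ∫ r in Set.Ioc 0 R, (2 * π)⁻¹ * (r * exp (-(1 / 2) * r ^ 2))
      = (2 * π)⁻¹ * (1 - exp (-R ^ 2 / 2)) := by
    rw [← intervalIntegral.integral_of_le hR, intervalIntegral.integral_const_mul,
      intervalIntegral.integral_eq_sub_of_hasDerivAt
        (f := fun r => -exp (-(1 / 2) * r ^ 2)) (fun r _ => ?_)
        (Continuous.intervalIntegrable (by fun_prop) _ _)]
    · rw [show -(1 / 2) * R ^ 2 = -R ^ 2 / 2 by ring]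
      norm_num
      ring
    · convert! (((hasDerivAt_pow 2 r).const_mul (-(1 / 2) : ℝ)).exp).neg using 1
      push_cast
      ring
  calc
    _ = ∫ p in Set.Ioi 0 ×ˢ Set.Ioo (-π) π, (Set.Ioc 0 R).indicator
          (fun r => (2 * π)⁻¹ * (r * exp (-(1 / 2) * r ^ 2))) p.1 * (fun _ => 1) p.2 := by
      rw [← integral_indicator (measurableSet_le (by fun_prop) (by fun_prop)),
        ← integral_comp_polarCoord_symm, polarCoord_target]
      refine setIntegral_congr_fun (measurableSet_Ioi.prod measurableSet_Ioo) ?_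
      rintro ⟨r, a⟩ ⟨hr, -⟩
      replace hr : 0 < r := hr
      beta_reduce
      have hsq : (r * cos a) ^ 2 + (r * sin a) ^ 2 = r ^ 2 := by
        linear_combination r ^ 2 * sin_sq_add_cos_sq a
      by_cases h : r ≤ R
      · rw [polarCoord_symm_apply, Set.indicator_of_mem, Set.indicator_of_mem]
        · simp only [gaussianPDFReal_zero_one, smul_eq_mul, mul_one]
          rw [← hpi, ← hsq, mul_add, exp_add]
          ring
        · exact ⟨hr, h⟩
        · rw [Set.mem_ofPred_eq, hsq]
          gcongr
      · rw [polarCoord_symm_apply, Set.indicator_of_notMem, Set.indicator_of_notMem]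
        · simp
        · exact fun h' => h h'.2
        · rw [Set.mem_ofPred_eq, hsq]
          exact fun h' => h (le_of_sq_le_sq h' hR)
    _ = 1 - exp (-R ^ 2 / 2) := by
      rw [Measure.volume_eq_prod, setIntegral_prod_mul (L := ℝ) _ (fun _ => 1),
        setIntegral_indicator measurableSet_Ioc,
        Set.inter_eq_right.2 Set.Ioc_subset_Ioi_self, hradial, setIntegral_const]
      simp only [volume_real_Ioo, smul_eq_mul, mul_one]
      rw [max_eq_left (by linarith [pi_pos])]
      field

lemma gaussianReal_real_eq {μ : ℝ} {v : NNReal} (hv : v ≠ 0) (s : Set ℝ) :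
    (gaussianReal μ v).real s = ∫ x in s, gaussianPDFReal μ v x := by
  rw [measureReal_def, gaussianReal_apply_eq_integral μ hv,
    ENNReal.toReal_ofReal (integral_nonneg (gaussianPDFReal_nonneg _ _))]

/-- The square `[-t, t]²` lies in the disc of radius `√2 * t`. -/
lemma gaussianReal_Icc_sq_le {t : ℝ} (ht : 0 ≤ t) :
    (gaussianReal 0 1).real (Set.Icc (-t) t) ^ 2 ≤ 1 - exp (-t ^ 2) := by
  have hdisc := setIntegral_disc_gaussianPDFReal (R := √2 * t) (by positivity)
  have hR : (√2 * t) ^ 2 = 2 * t ^ 2 := by rw [mul_pow, sq_sqrt (by norm_num)]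
  rw [hR, show -(2 * t ^ 2) / 2 = -t ^ 2 by ring] at hdisc
  have hi := integrable_gaussianPDFReal 0 1
  rw [← hdisc, sq, gaussianReal_real_eq one_ne_zero, ← setIntegral_prod_mul,
    ← Measure.volume_eq_prod]
  refine setIntegral_mono_set (hi.mul_prod hi).integrableOn
    (ae_of_all _ fun z => mul_nonneg (gaussianPDFReal_nonneg _ _ _) (gaussianPDFReal_nonneg _ _ _))
    (Filter.Eventually.of_forall ?_)
  rintro ⟨x, y⟩ ⟨hx, hy⟩
  have h1 := sq_le_sq' hx.1 hx.2
  have h2 := sq_le_sq' hy.1 hy.2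
  change _ + _ ≤ _
  linarith

lemma gaussianReal_Iio_neg (t : ℝ) :
    (gaussianReal 0 1).real (Set.Iio (-t)) = (gaussianReal 0 1).real (Set.Ioi t) := by
  have h := gaussianReal_map_neg (μ := 0) (v := 1)
  rw [neg_zero] at h
  conv_rhs => rw [← h]
  rw [map_measureReal_apply measurable_neg measurableSet_Ioi]
  congr 1 with x
  simp

lemma gaussianPDFReal_sq_le_of_nonneg {t : ℝ} (ht : 0 ≤ t) :
    gaussianPDFReal 0 1 t ^ 2 ≤ 2 / π *
      ((gaussianReal 0 1).real (Set.Ioi t) * (1 - (gaussianReal 0 1).real (Set.Ioi t))) := by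
  have hsplit : (gaussianReal 0 1).real (Set.Icc (-t) t)
      = 1 - 2 * (gaussianReal 0 1).real (Set.Ioi t) := by
    have hc : (Set.Icc (-t) t)ᶜ = Set.Iio (-t) ∪ Set.Ioi t := by
      ext x
      simp only [Set.mem_compl_iff, Set.mem_Icc, not_and_or, not_le, Set.mem_union,
        Set.mem_Iio, Set.mem_Ioi]
    have hd : Disjoint (Set.Iio (-t)) (Set.Ioi t) :=
      Set.disjoint_left.2 fun x hx hx' => by
        simp only [Set.mem_Iio, Set.mem_Ioi] at hx hx'
        linarith
    have h := probReal_compl_eq_one_sub (μ := gaussianReal 0 1)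
      (measurableSet_Icc (a := -t) (b := t))
    rw [hc, measureReal_union hd measurableSet_Ioi, gaussianReal_Iio_neg] at h
    linarith
  have hsq := gaussianReal_Icc_sq_le ht
  rw [hsplit] at hsq
  have hval : gaussianPDFReal 0 1 t ^ 2 = 2 / π * (exp (-t ^ 2) / 4) := by
    rw [gaussianPDFReal_zero_one, mul_pow, inv_pow, sq_sqrt (by positivity), ← exp_nat_mul,
      show ((2 : ℕ) : ℝ) * (-(1 / 2) * t ^ 2) = -t ^ 2 by push_cast; ring]
    field
  rw [hval]
  gcongr
  linarith

lemma gaussianPDFReal_sq_le (t : ℝ) :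
    gaussianPDFReal 0 1 t ^ 2 ≤ 2 / π *
      ((gaussianReal 0 1).real (Set.Ioi t) * (1 - (gaussianReal 0 1).real (Set.Ioi t))) := by
  rcases le_total 0 t with ht | ht
  · exact gaussianPDFReal_sq_le_of_nonneg ht
  · have := nullSingletonClass_gaussianReal (μ := 0) (v := 1) one_ne_zero
    have h := gaussianPDFReal_sq_le_of_nonneg (neg_nonneg.2 ht)
    have heven : gaussianPDFReal 0 1 (-t) = gaussianPDFReal 0 1 t := by
      simp only [gaussianPDFReal_zero_one, neg_sq]
    have hflip : (gaussianReal 0 1).real (Set.Ioi (-t))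
        = 1 - (gaussianReal 0 1).real (Set.Ioi t) := by
      rw [← gaussianReal_Iio_neg, neg_neg, measureReal_congr Iio_ae_eq_Iic, ← Set.compl_Ioi,
        probReal_compl_eq_one_sub measurableSet_Ioi]
    rw [heven, hflip] at h
    linarith

lemma setIntegral_id_gaussianReal_sq_le {B : Set ℝ} (hB : MeasurableSet B)
    (h0 : 0 < (gaussianReal 0 1).real B) (h1 : (gaussianReal 0 1).real B < 1) :
    (∫ x in B, x ∂gaussianReal 0 1) ^ 2 ≤ 2 / π *
      ((gaussianReal 0 1).real B * (1 - (gaussianReal 0 1).real B)) := by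
  wlog hpos : 0 ≤ ∫ x in B, x ∂gaussianReal 0 1 generalizing B
  · have hadd := integral_add_compl hB (integrable_id_gaussianReal 0 1)
    rw [integral_id_gaussianReal] at hadd
    have hc := probReal_compl_eq_one_sub (μ := gaussianReal 0 1) hB
    have h := this hB.compl (by linarith) (by linarith) (by linarith)
    rw [hc, eq_neg_of_add_eq_zero_right hadd, neg_sq] at h
    linarith
  obtain ⟨t, ht⟩ := exists_gaussianReal_Ioi_eq h0 h1
  rw [← ht]
  refine le_trans ?_ (gaussianPDFReal_sq_le t)
  gcongr
  exact setIntegral_id_gaussianReal_le hB ht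

lemma hasDerivAt_gaussianReal_real {B : Set ℝ} (hB : MeasurableSet B) :
    HasDerivAt (fun s => (gaussianReal s 1).real B) (∫ x in B, x ∂gaussianReal 0 1) 0 := by
  have hset : integrableExpSet id ((gaussianReal 0 1).restrict B) = Set.univ :=
    Set.eq_univ_of_forall fun s => (integrable_exp_mul_gaussianReal s).integrableOn
  have hmgf := hasDerivAt_mgf (X := id) (μ := (gaussianReal 0 1).restrict B) (t := 0)
    (by rw [hset, interior_univ]; trivial)
  have hexp := ((hasDerivAt_pow 2 (0 : ℝ)).const_mul (-(1 / 2) : ℝ)).exp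
  convert! hexp.mul hmgf using 1
  · ext s
    rw [Pi.mul_apply, mgf, setIntegral_gaussianReal one_ne_zero hB,
      gaussianReal_real_eq one_ne_zero, ← integral_const_mul]
    congr 1 with x
    simp only [gaussianPDFReal, NNReal.coe_one, id]
    rw [mul_left_comm, mul_assoc, mul_assoc, ← exp_add, ← exp_add]
    ring_nf
  · simp

lemma gaussianReal_real_affine {σ : ℝ} (hσ : 0 < σ) (θ s : ℝ) {A : Set ℝ} (hA : MeasurableSet A) :
    (gaussianReal s (σ ^ 2).toNNReal).real A
      = (gaussianReal ((s - θ) / σ) 1).real ((fun x => σ * x + θ) ⁻¹' A) := by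
  have h : (gaussianReal ((s - θ) / σ) 1).map (fun x => σ * x + θ)
      = gaussianReal s (σ ^ 2).toNNReal := by
    rw [← Function.comp_def (· + θ) (σ * ·), ← Measure.map_map (by fun_prop) (by fun_prop),
      gaussianReal_map_const_mul, gaussianReal_map_add_const]
    congr 1
    · field
    · ext
      simp [sq_nonneg]
  rw [← h, map_measureReal_apply (by fun_prop) hA]

/-- For `X ~ N(θ,σ²)` and a measurable set `A`, let `p(θ) = P(X ∈ A)`. If `0 < p(θ) < 1`,
then `p` is differentiable at `θ` and the Fisher information of the one-bit message
`M = sgn-indicator of A` satisfies `(p'(θ))²/(p(θ)(1 − p(θ))) ≤ 2/(πσ²)`. -/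
theorem one_bit_fisher_info_le (σ θ : ℝ) (hσ : 0 < σ) (A : Set ℝ) (hA : MeasurableSet A)
    (p : ℝ → ℝ)
    (hp : p = fun t => (gaussianReal t ((σ ^ 2).toNNReal) A).toReal)
    (hp_pos : 0 < p θ) (hp_lt : p θ < 1) :
    DifferentiableAt ℝ p θ ∧
      (deriv p θ) ^ 2 / (p θ * (1 - p θ)) ≤ 2 / (Real.pi * σ ^ 2) := by
  set B := (fun x => σ * x + θ) ⁻¹' A
  have hB : MeasurableSet B := hA.preimage (by fun_prop)
  have hpB : p = (fun s => (gaussianReal s 1).real B) ∘ fun t => (t - θ) / σ := by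
    rw [hp]
    exact funext fun t => gaussianReal_real_affine hσ θ t hA
  have hpθ : p θ = (gaussianReal 0 1).real B := by simp [hpB]
  have hd : HasDerivAt p ((∫ x in B, x ∂gaussianReal 0 1) * (1 / σ)) θ := by
    rw [hpB]
    refine HasDerivAt.comp θ ?_ (((hasDerivAt_id θ).sub_const θ).div_const σ)
    simpa using hasDerivAt_gaussianReal_real hB
  refine ⟨hd.differentiableAt, ?_⟩
  have hle := setIntegral_id_gaussianReal_sq_le hB (hpθ ▸ hp_pos) (hpθ ▸ hp_lt)
  rw [← hpθ] at hle
  rw [hd.deriv, div_le_iff₀ (mul_pos hp_pos (by linarith))]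
  calc _ = (∫ x in B, x ∂gaussianReal 0 1) ^ 2 * (1 / σ ^ 2) := by ring
    _ ≤ 2 / π * (p θ * (1 - p θ)) * (1 / σ ^ 2) := by gcongr
    _ = _ := by field
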